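/- arXiv:1102.4394 — 2 statements merged into one kernel-verified Lean document; each statement's English description precedes it below -/
import Mathlib

section
/- Let q ≥ p ≥ 2. There exist constants C > 0 and d > 0 such that for every smooth complex-valued function g on [−1,1] vanishing in a neighborhood of s = 1 and of s = −1, one has |g(0)|^{q(p−1)+p} ≤ C · ( ∫_{−1}^{1} |g′(s)|^p (1−|s|)^{p−1} ds + d |g(0)|^p ) · ( ∫_{−1}^{1} |g(s)|^q (1−|s|)^{q(p−1)/p} ds )^{p−1}. -/
open MeasureTheory Set

/-- A truncated Young inequality, with both sides homogeneous of degree one in `(x, t)`. -/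
lemma le_add_rpow_mul_rpow {x t p : ℝ} (hx : 0 ≤ x) (ht : 0 < t) (hp : 1 ≤ p) :
    x ≤ t + t ^ (1 - p) * x ^ p := by
  rcases le_total x t with h | h
  · have : 0 ≤ t ^ (1 - p) * x ^ p := by positivity
    linarith
  · have hx0 : 0 < x := ht.trans_le h
    have h1 : x ^ (1 - p) ≤ t ^ (1 - p) := Real.rpow_le_rpow_of_nonpos ht h (by linarith)
    have h2 : x ^ (1 - p) * x ^ p = x := by
      rw [← Real.rpow_add hx0, sub_add_cancel, Real.rpow_one]
    have h3 : x ^ (1 - p) * x ^ p ≤ t ^ (1 - p) * x ^ p := by gcongr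
    linarith

lemma integrableOn_norm_rpow_mul_weight {f : ℝ → ℂ} {r β : ℝ} (hr : 0 ≤ r) (hβ : 0 ≤ β)
    (hf : ContinuousOn f (Icc (-1) 1)) :
    IntegrableOn (fun s => ‖f s‖ ^ r * (1 - |s|) ^ β) (Ioo (-1) 1) := by
  refine (ContinuousOn.integrableOn_Icc ?_).mono_set Ioo_subset_Icc_self
  refine (hf.norm.rpow_const fun _ _ => Or.inr hr).mul ?_
  exact ContinuousOn.rpow_const (by fun_prop) fun _ _ => Or.inr hβ

lemma integrableOn_norm_deriv_rpow_mul_weight {g : ℝ → ℂ} {r β : ℝ} (hr : 0 ≤ r) (hβ : 0 ≤ β)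
    (hg : ContDiffOn ℝ (⊤ : ℕ∞) g (Icc (-1) 1)) :
    IntegrableOn (fun s => ‖deriv g s‖ ^ r * (1 - |s|) ^ β) (Ioo (-1) 1) := by
  have hc : ContinuousOn (derivWithin g (Icc (-1) 1)) (Icc (-1) 1) :=
    hg.continuousOn_derivWithin (uniqueDiffOn_Icc (by norm_num)) (by norm_cast)
  refine (integrableOn_norm_rpow_mul_weight hr hβ hc).congr_fun (fun s hs => ?_) measurableSet_Ioo
  simp only [derivWithin_of_mem_nhds (Icc_mem_nhds hs.1 hs.2)]

/-- On `[0, 1/2]` the weight is bounded below, so the increment of `g` is controlled by the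
weighted energy, with a free parameter `t`. -/
lemma norm_sub_zero_le {g : ℝ → ℂ} {p s t : ℝ} (hp : 1 ≤ p) (hs : 0 ≤ s) (hs' : s ≤ 1 / 2)
    (ht : 0 < t) (hg : ContDiffOn ℝ (⊤ : ℕ∞) g (Icc (-1) 1)) :
    ‖g s - g 0‖ ≤ s * t + t ^ (1 - p) * 2 ^ (p - 1) *
      ∫ u in Ioo (-1 : ℝ) 1, ‖deriv g u‖ ^ p * (1 - |u|) ^ (p - 1) := by
  set F : ℝ → ℝ := fun u => ‖deriv g u‖ ^ p * (1 - |u|) ^ (p - 1)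
  have hsub : Icc 0 s ⊆ Ioo (-1 : ℝ) 1 := fun u hu => ⟨by linarith [hu.1], by linarith [hu.2]⟩
  have hF : IntegrableOn F (Ioo (-1) 1) :=
    integrableOn_norm_deriv_rpow_mul_weight (by linarith) (by linarith) hg
  have hg' : ContDiffOn ℝ (⊤ : ℕ∞) g (Ioo (-1) 1) := hg.mono Ioo_subset_Icc_self
  have hc : ContinuousOn (deriv g) (Icc 0 s) :=
    (hg'.continuousOn_deriv_of_isOpen isOpen_Ioo (by norm_cast)).mono hsub
  have hFTC : ∫ u in (0 : ℝ)..s, deriv g u = g s - g 0 := by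
    refine intervalIntegral.integral_deriv_eq_sub (fun u hu => ?_) ?_
    · rw [uIcc_of_le hs] at hu
      exact (hg'.contDiffAt (isOpen_Ioo.mem_nhds (hsub hu))).differentiableAt (by simp)
    · exact ContinuousOn.intervalIntegrable (by rwa [uIcc_of_le hs])
  have hFs : IntervalIntegrable F volume 0 s := by
    rw [intervalIntegrable_iff_integrableOn_Ioc_of_le hs]
    exact hF.mono_set (Ioc_subset_Icc_self.trans hsub)
  have hnonneg : ∀ u ∈ Ioo (-1 : ℝ) 1, 0 ≤ F u := fun u hu => by
    have : 0 ≤ 1 - |u| := by linarith [abs_lt.2 hu]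
    positivity
  have hpt : ∀ u ∈ Icc 0 s, ‖deriv g u‖ ≤ t + t ^ (1 - p) * 2 ^ (p - 1) * F u := fun u hu => by
    have h1 := le_add_rpow_mul_rpow (norm_nonneg (deriv g u)) ht hp
    have hw : (1 : ℝ) ≤ 2 ^ (p - 1) * (1 - |u|) ^ (p - 1) := by
      rw [abs_of_nonneg hu.1, ← Real.mul_rpow (by norm_num) (by linarith [hu.2])]
      exact Real.one_le_rpow (by linarith [hu.2]) (by linarith)
    have h2 : 0 ≤ t ^ (1 - p) * ‖deriv g u‖ ^ p := by positivity
    have h3 := mul_le_mul_of_nonneg_left hw h2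
    calc ‖deriv g u‖ ≤ t + t ^ (1 - p) * ‖deriv g u‖ ^ p * 1 := by rwa [mul_one]
      _ ≤ _ := by simp only [F]; linarith
  calc ‖g s - g 0‖ = ‖∫ u in (0 : ℝ)..s, deriv g u‖ := by rw [hFTC]
    _ ≤ ∫ u in (0 : ℝ)..s, ‖deriv g u‖ := intervalIntegral.norm_integral_le_integral_norm hs
    _ ≤ ∫ u in (0 : ℝ)..s, (t + t ^ (1 - p) * 2 ^ (p - 1) * F u) := by
      refine intervalIntegral.integral_mono_on hs ?_ ?_ hpt
      · exact ContinuousOn.intervalIntegrable (by rw [uIcc_of_le hs]; exact hc.norm)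
      · exact intervalIntegrable_const.add (hFs.const_mul _)
    _ = s * t + t ^ (1 - p) * 2 ^ (p - 1) * ∫ u in (0 : ℝ)..s, F u := by
      rw [intervalIntegral.integral_add intervalIntegrable_const (hFs.const_mul _),
        intervalIntegral.integral_const, intervalIntegral.integral_const_mul]
      simp
    _ ≤ _ := by
      gcongr
      rw [intervalIntegral.integral_of_le hs]
      refine setIntegral_mono_set hF ?_ (Ioc_subset_Icc_self.trans hsub).eventuallyLE
      exact (ae_restrict_iff' measurableSet_Ioo).2 (.of_forall hnonneg)

/-- If `g` stays at least `b` in modulus on `[0, δ] ⊆ [0, 1/2]`, its weighted integral is bounded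
below by a multiple of `δ * b ^ q`. -/
lemma mul_rpow_le_integral {g : ℝ → ℂ} {q β b δ : ℝ} (hq : 0 ≤ q) (hβ : 0 ≤ β) (hb : 0 ≤ b)
    (hδ : 0 ≤ δ) (hδ' : δ ≤ 1 / 2) (hg : ContinuousOn g (Icc (-1) 1))
    (hgb : ∀ s ∈ Icc 0 δ, b ≤ ‖g s‖) :
    δ * (b ^ q * (1 / 2) ^ β) ≤ ∫ s in Ioo (-1 : ℝ) 1, ‖g s‖ ^ q * (1 - |s|) ^ β := by
  have hG := integrableOn_norm_rpow_mul_weight hq hβ hg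
  have hsub : Icc 0 δ ⊆ Ioo (-1 : ℝ) 1 := fun u hu => ⟨by linarith [hu.1], by linarith [hu.2]⟩
  calc δ * (b ^ q * (1 / 2) ^ β) = ∫ _ in Icc 0 δ, b ^ q * (1 / 2 : ℝ) ^ β := by
        simp [hδ]
    _ ≤ ∫ s in Icc 0 δ, ‖g s‖ ^ q * (1 - |s|) ^ β := by
      refine setIntegral_mono_on (integrableOn_const (by simp)) (hG.mono_set hsub)
        measurableSet_Icc fun s hs => ?_
      have hw : 1 / 2 ≤ 1 - |s| := by rw [abs_of_nonneg hs.1]; linarith [hs.2]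
      have := hgb s hs
      gcongr
    _ ≤ _ := by
      refine setIntegral_mono_set hG ?_ hsub.eventuallyLE
      refine (ae_restrict_iff' measurableSet_Ioo).2 (.of_forall fun u hu => ?_)
      have : 0 ≤ 1 - |u| := by linarith [abs_lt.2 hu]
      simp only [Pi.zero_apply]
      positivity

/-- The key weighted one-dimensional `L^p` inequality (inequality (2.4) in the proof of
Proposition 2): for `q ≥ p ≥ 2` there are constants `C > 0` and `d > 0` such that for every
smooth `g` on `[−1,1]` vanishing near `s = ±1`,
`|g(0)|^{q(p−1)+p} ≤ C (∫_{−1}^1 |g'|^p (1−|s|)^{p−1} ds + d |g(0)|^p)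
(∫_{−1}^1 |g|^q (1−|s|)^{q(p−1)/p} ds)^{p−1}`. -/
theorem one_dim_weighted_key_p (p q : ℝ) (hp : 2 ≤ p) (hpq : p ≤ q) :
    ∃ C : ℝ, 0 < C ∧ ∃ d : ℝ, 0 < d ∧ ∀ g : ℝ → ℂ,
      ContDiffOn ℝ (⊤ : ℕ∞) g (Set.Icc (-1) 1) →
      (∃ ε > 0, ∀ s ∈ Set.Icc (-1 : ℝ) 1, 1 - ε < |s| → g s = 0) →
      ‖g 0‖ ^ (q * (p - 1) + p) ≤ C *
        ((∫ s in Set.Ioo (-1 : ℝ) 1, ‖deriv g s‖ ^ p * (1 - |s|) ^ (p - 1)) +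
          d * ‖g 0‖ ^ p) *
        (∫ s in Set.Ioo (-1 : ℝ) 1, ‖g s‖ ^ q * (1 - |s|) ^ (q * (p - 1) / p)) ^ (p - 1) := by
  have hp0 : 0 < p := by linarith
  have hp1 : 0 < p - 1 := by linarith
  have hq : 0 < q := by linarith
  have hβ : 0 ≤ q * (p - 1) / p := by positivity
  set β := q * (p - 1) / p
  set m : ℝ := (1 / 2) ^ q * (1 / 2) ^ β
  have hm : 0 < m := by positivity
  refine ⟨8 ^ p / m ^ (p - 1), by positivity, 1, one_pos, fun g hg _ => ?_⟩
  rw [one_mul]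
  set A := ∫ s in Ioo (-1 : ℝ) 1, ‖deriv g s‖ ^ p * (1 - |s|) ^ (p - 1)
  set B := ∫ s in Ioo (-1 : ℝ) 1, ‖g s‖ ^ q * (1 - |s|) ^ β
  have hweight : ∀ s ∈ Ioo (-1 : ℝ) 1, 0 ≤ 1 - |s| := fun s hs => by linarith [abs_lt.2 hs]
  have hA : 0 ≤ A := setIntegral_nonneg measurableSet_Ioo fun s hs => by
    have := hweight s hs
    positivity
  have hB : 0 ≤ B := setIntegral_nonneg measurableSet_Ioo fun s hs => by
    have := hweight s hs
    positivity
  rcases (norm_nonneg (g 0)).eq_or_lt with ha | ha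
  · rw [← ha, Real.zero_rpow (by positivity)]
    positivity
  set a := ‖g 0‖
  set E := A + a ^ p
  have hE : 0 < E := by positivity
  have hratio : 8 ^ (-p) * (a ^ p / E) ≤ (8 : ℝ) ^ (-p) :=
    mul_le_of_le_one_right (by positivity) ((div_le_one hE).2 (by simp only [E]; linarith))
  obtain ⟨δ, hδ, hδE⟩ : ∃ δ : ℝ, 0 < δ ∧ δ ^ (p - 1) = 8 ^ (-p) * (a ^ p / E) :=
    ⟨(8 ^ (-p) * (a ^ p / E)) ^ (p - 1)⁻¹, by positivity,
      Real.rpow_inv_rpow (by positivity) hp1.ne'⟩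
  have hδ' : δ ≤ 1 / 2 := by
    rw [← Real.rpow_le_rpow_iff hδ.le (by norm_num) hp1, hδE]
    refine hratio.trans ?_
    rw [Real.rpow_neg (by norm_num), one_div, Real.inv_rpow (by norm_num)]
    gcongr
    calc (2 : ℝ) ^ (p - 1) ≤ 2 ^ p := by gcongr <;> linarith
      _ ≤ 8 ^ p := by gcongr; norm_num
  have hlower : ∀ s ∈ Icc 0 δ, a * (1 / 2) ≤ ‖g s‖ := fun s hs => by
    have ht : 0 < a / (4 * δ) := by positivity
    have h := norm_sub_zero_le (p := p) (by linarith) hs.1 (hs.2.trans hδ') ht hg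
    have h1 : s * (a / (4 * δ)) ≤ a / 4 := by
      calc s * (a / (4 * δ)) ≤ δ * (a / (4 * δ)) := by gcongr; exact hs.2
        _ = a / 4 := by field_simp
    have h2 : (a / (4 * δ)) ^ (1 - p) * 2 ^ (p - 1) * A ≤ a / 8 := by
      have e1 : (a / (4 * δ)) ^ (1 - p) * 2 ^ (p - 1) = 8 ^ (p - 1) * δ ^ (p - 1) / a ^ (p - 1) := by
        rw [← neg_sub p 1, Real.rpow_neg ht.le, ← Real.inv_rpow ht.le, inv_div,
          ← Real.mul_rpow (by positivity) (by norm_num), ← Real.mul_rpow (by norm_num) hδ.le,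
          ← Real.div_rpow (by positivity) ha.le]
        congr 1
        ring
      have e2 : 8 ^ (p - 1) * δ ^ (p - 1) / a ^ (p - 1) = a / 8 / E := by
        rw [hδE, Real.rpow_sub_one (by norm_num), Real.rpow_sub_one ha.ne',
          Real.rpow_neg (by norm_num)]
        field_simp
      rw [e1, e2, div_mul_eq_mul_div, div_le_iff₀ hE]
      gcongr
      have : 0 ≤ a ^ p := by positivity
      simp only [E]
      linarith
    have h3 : a ≤ ‖g s‖ + ‖g s - g 0‖ := norm_le_norm_add_norm_sub _ _
    linarith
  have hBlower : δ * (m * a ^ q) ≤ B := by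
    have h := mul_rpow_le_integral hq.le hβ (by positivity) hδ.le hδ' hg.continuousOn hlower
    rw [Real.mul_rpow ha.le (by norm_num)] at h
    calc δ * (m * a ^ q) = δ * (a ^ q * (1 / 2) ^ q * (1 / 2) ^ β) := by simp only [m]; ring
      _ ≤ B := h
  calc a ^ (q * (p - 1) + p)
      = 8 ^ p / m ^ (p - 1) * E * (δ * (m * a ^ q)) ^ (p - 1) := by
        rw [Real.mul_rpow hδ.le (by positivity), Real.mul_rpow hm.le (by positivity), hδE,
          ← Real.rpow_mul ha.le, Real.rpow_add ha, Real.rpow_neg (by norm_num)]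
        field_simp
    _ ≤ 8 ^ p / m ^ (p - 1) * E * B ^ (p - 1) := by gcongr
end

section
/- Let N ≥ 1. For every open set Ω ⊊ ℝ^N and every u ∈ C_0^∞(Ω) one has ∫_Ω |∇u|² dx ≥ (1/4) ∫_Ω |u|²/D_Ω(x)² dx. -/
open MeasureTheory Metric Set

noncomputable def dirDist {N : ℕ} (Ω : Set (EuclideanSpace ℝ (Fin N)))
    (x e : EuclideanSpace ℝ (Fin N)) : ℝ :=
  sInf {r : ℝ | ∃ t : ℝ, r = |t| ∧ x + t • e ∈ Ωᶜ}

noncomputable def daviesWeight {N : ℕ} (Ω : Set (EuclideanSpace ℝ (Fin N)))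
    (x : EuclideanSpace ℝ (Fin N)) : ℝ :=
  ((N : ℝ) * ⨍ e : sphere (0 : EuclideanSpace ℝ (Fin N)) 1,
      (dirDist Ω x (e : EuclideanSpace ℝ (Fin N)) ^ 2)⁻¹ ∂volume.toSphere) ^ (-(1:ℝ)/2)

section Ray

variable {E : Type*} [NormedAddCommGroup E] [NormedSpace ℝ E]

/-- Nonnegative parameters at which the ray from `x` in direction `e` lies outside `Ω`. -/
def rayExit (Ω : Set E) (x e : E) : Set ℝ := {t | 0 ≤ t ∧ x + t • e ∈ Ωᶜ}

/-- The reciprocal of the distance from `x` to `Ωᶜ` along the ray in direction `e`;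
it vanishes if the ray stays in `Ω` or if `x ∉ Ω`. -/
noncomputable def rayInv (Ω : Set E) (x e : E) : ℝ := (sInf (rayExit Ω x e))⁻¹

lemma bddBelow_rayExit (Ω : Set E) (x e : E) : BddBelow (rayExit Ω x e) :=
  ⟨0, fun _ ht => ht.1⟩

lemma rayInv_nonneg (Ω : Set E) (x e : E) : 0 ≤ rayInv Ω x e :=
  inv_nonneg.2 (Real.sInf_nonneg fun _ ht => ht.1)

lemma isClosed_rayExit {Ω : Set E} (hΩ : IsOpen Ω) (x e : E) : IsClosed (rayExit Ω x e) :=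
  isClosed_Ici.inter (hΩ.isClosed_compl.preimage (by fun_prop : Continuous fun t : ℝ => x + t • e))

lemma isLeast_rayExit {Ω : Set E} (hΩ : IsOpen Ω) {x e : E} (h : (rayExit Ω x e).Nonempty) :
    IsLeast (rayExit Ω x e) (sInf (rayExit Ω x e)) :=
  ⟨(isClosed_rayExit hΩ x e).csInf_mem h (bddBelow_rayExit Ω x e),
    fun _ ht => csInf_le (bddBelow_rayExit Ω x e) ht⟩

lemma pos_of_mem_rayExit {Ω : Set E} {x e : E} (hx : x ∈ Ω) {t : ℝ} (ht : t ∈ rayExit Ω x e) :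
    0 < t := by
  refine ht.1.lt_of_ne ?_
  rintro rfl
  exact ht.2 (by simpa using hx)

lemma rayInv_of_notMem {Ω : Set E} {x : E} (hx : x ∉ Ω) (e : E) : rayInv Ω x e = 0 := by
  have h : IsLeast (rayExit Ω x e) 0 := ⟨⟨le_rfl, by simpa using hx⟩, fun _ ht => ht.1⟩
  simp [rayInv, h.csInf_eq]

lemma inv_le_rayInv {Ω : Set E} (hΩ : IsOpen Ω) {x e : E} (hx : x ∈ Ω) {t : ℝ}
    (ht : t ∈ rayExit Ω x e) : t⁻¹ ≤ rayInv Ω x e := by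
  have h := isLeast_rayExit hΩ ⟨t, ht⟩
  exact inv_anti₀ (pos_of_mem_rayExit hx h.1) (h.2 ht)

lemma rayInv_le_inv {Ω : Set E} {x e : E} {c : ℝ} (hc : 0 < c)
    (h : ∀ t ∈ rayExit Ω x e, c ≤ t) : rayInv Ω x e ≤ c⁻¹ := by
  rcases (rayExit Ω x e).eq_empty_or_nonempty with h0 | h0
  · simp [rayInv, h0, hc.le]
  · exact inv_anti₀ hc (le_csInf h0 h)

lemma le_rayInv_iff {Ω : Set E} (hΩ : IsOpen Ω) {x e : E} {c : ℝ} (hc : 0 < c) :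
    c ≤ rayInv Ω x e ↔ x ∈ Ω ∧ ∃ t ∈ Icc 0 c⁻¹, x + t • e ∈ Ωᶜ := by
  constructor
  · intro h
    have hx : x ∈ Ω := by
      by_contra hx
      rw [rayInv_of_notMem hx] at h
      exact hc.not_ge h
    refine ⟨hx, ?_⟩
    rcases (rayExit Ω x e).eq_empty_or_nonempty with h0 | h0
    · simp [rayInv, h0] at h
      exact absurd h hc.not_ge
    · have hm := isLeast_rayExit hΩ h0
      refine ⟨_, ⟨hm.1.1, ?_⟩, hm.1.2⟩
      exact (le_inv_comm₀ hc (pos_of_mem_rayExit hx hm.1)).1 h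
  · rintro ⟨hx, t, ht, hte⟩
    have hmem : t ∈ rayExit Ω x e := ⟨ht.1, hte⟩
    refine le_trans ?_ (inv_le_rayInv hΩ hx hmem)
    exact (le_inv_comm₀ (pos_of_mem_rayExit hx hmem) hc).1 ht.2

lemma measurable_rayInv [MeasurableSpace E] [BorelSpace E] [SecondCountableTopology E]
    {Ω : Set E} (hΩ : IsOpen Ω) : Measurable fun p : E × E => rayInv Ω p.1 p.2 := by
  refine measurable_of_Ici fun c => ?_
  rcases le_or_gt c 0 with hc | hc
  · convert MeasurableSet.univ
    ext p
    simpa using hc.trans (rayInv_nonneg Ω p.1 p.2)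
  · have hcl : IsClosed (Prod.snd '' {q : Icc 0 c⁻¹ × (E × E) | q.2.1 + (q.1 : ℝ) • q.2.2 ∈ Ωᶜ}) :=
      isClosedMap_snd_of_compactSpace _ (hΩ.isClosed_compl.preimage (by fun_prop))
    convert (hΩ.measurableSet.preimage measurable_fst).inter hcl.measurableSet
    ext p
    simp only [mem_preimage, mem_Ici, le_rayInv_iff hΩ hc, mem_inter_iff, mem_image]
    refine and_congr_right fun _ => ⟨?_, ?_⟩
    · rintro ⟨t, ht, h⟩
      exact ⟨(⟨t, ht⟩, p), h, rfl⟩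
    · rintro ⟨q, hq, rfl⟩
      exact ⟨q.1, q.1.2, hq⟩

lemma Measurable.rayInv {α : Type*} [MeasurableSpace α] [MeasurableSpace E] [BorelSpace E]
    [SecondCountableTopology E] {Ω : Set E} (hΩ : IsOpen Ω) {f g : α → E} (hf : Measurable f)
    (hg : Measurable g) : Measurable fun a => rayInv Ω (f a) (g a) := by
  have h := (measurable_rayInv hΩ).comp (hf.prodMk hg)
  simpa only [Function.comp_def] using h

lemma hasLineDerivAt_rayInv {Ω : Set E} (hΩ : IsOpen Ω) {x : E} (hx : x ∈ Ω) (e : E) :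
    HasLineDerivAt ℝ (fun y => rayInv Ω y e) (rayInv Ω x e ^ 2) x e := by
  have hop : IsOpen {t : ℝ | x + t • e ∈ Ω} := hΩ.preimage (by fun_prop)
  obtain ⟨ε, hε, hball⟩ := Metric.isOpen_iff.1 hop 0 (by simpa using hx)
  have key : ∀ s : ℝ, |s| < ε → ∀ t, t - s ∈ rayExit Ω (x + s • e) e ↔ t ∈ rayExit Ω x e := by
    intro s hs t
    have hts : x + s • e + (t - s) • e = x + t • e := by module
    simp only [rayExit, mem_ofPred_eq, hts]
    refine and_congr_left fun ht => ?_
    have hεt : ε ≤ |t| := by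
      by_contra! h
      exact ht (hball (by simpa using h))
    rw [abs_lt] at hs
    rcases abs_cases t with h | h <;> constructor <;> intro <;> linarith
  rw [HasLineDerivAt]
  have hnear : ∀ᶠ s : ℝ in nhds 0, |s| < ε := by
    filter_upwards [Metric.ball_mem_nhds (0 : ℝ) hε] with s hs
    simpa using hs
  rcases (rayExit Ω x e).eq_empty_or_nonempty with h0 | h0
  · have h1 : (fun s : ℝ => rayInv Ω (x + s • e) e) =ᶠ[nhds 0] fun _ => 0 := by
      filter_upwards [hnear] with s hs
      have : rayExit Ω (x + s • e) e = ∅ := by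
        refine eq_empty_of_forall_notMem fun t ht => ?_
        have := (key s hs (t + s)).1 (by simpa using ht)
        simp [h0] at this
      simp [rayInv, this]
    have h2 : rayInv Ω x e = 0 := by simp [rayInv, h0]
    rw [h2]
    simpa using (hasDerivAt_const (0 : ℝ) (0 : ℝ)).congr_of_eventuallyEq h1
  · have hm := isLeast_rayExit hΩ h0
    have hpos := pos_of_mem_rayExit hx hm.1
    set m := sInf (rayExit Ω x e) with hmdef
    have h1 : (fun s : ℝ => rayInv Ω (x + s • e) e) =ᶠ[nhds 0] fun s => (m - s)⁻¹ := by
      filter_upwards [hnear] with s hs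
      have : IsLeast (rayExit Ω (x + s • e) e) (m - s) := by
        refine ⟨(key s hs m).2 hm.1, fun t ht => ?_⟩
        have := hm.2 ((key s hs (t + s)).1 (by simpa using ht))
        linarith
      rw [rayInv, this.csInf_eq]
    have h2 : HasDerivAt (fun s : ℝ => (m - s)⁻¹) (rayInv Ω x e ^ 2) 0 := by
      refine (((hasDerivAt_id (0 : ℝ)).const_sub m).inv (by simpa using hpos.ne')).congr_deriv ?_
      simp [rayInv, hmdef]
    exact h2.congr_of_eventuallyEq h1

lemma hasLineDerivAt_rayInv_neg {Ω : Set E} (hΩ : IsOpen Ω) {x : E} (hx : x ∈ Ω) (e : E) :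
    HasLineDerivAt ℝ (fun y => rayInv Ω y (-e)) (-rayInv Ω x (-e) ^ 2) x e := by
  simpa using (hasLineDerivAt_rayInv hΩ hx (-e)).smul (-1)

end Ray

section Sphere

open scoped Pointwise

variable {E : Type*} [NormedAddCommGroup E] [InnerProductSpace ℝ E]

/-- The self-map of the unit sphere induced by a linear isometry. -/
def sphereIsometry (R : E ≃ₗᵢ[ℝ] E) (e : sphere (0 : E) 1) : sphere (0 : E) 1 :=
  ⟨R e, by simp⟩

lemma continuous_sphereIsometry (R : E ≃ₗᵢ[ℝ] E) : Continuous (sphereIsometry R) :=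
  (R.continuous.comp continuous_subtype_val).subtype_mk _

variable [FiniteDimensional ℝ E] [MeasurableSpace E] [BorelSpace E]

lemma measurePreserving_sphereIsometry (R : E ≃ₗᵢ[ℝ] E) :
    MeasurePreserving (sphereIsometry R) (volume : Measure E).toSphere
      (volume : Measure E).toSphere := by
  have hmeas := (continuous_sphereIsometry R).measurable
  refine ⟨hmeas, Measure.ext fun s hs => ?_⟩
  rw [Measure.map_apply hmeas hs, Measure.toSphere_apply' _ hs,
    Measure.toSphere_apply' _ (hmeas hs)]
  have h : Ioo (0 : ℝ) 1 • ((↑) '' (sphereIsometry R ⁻¹' s) : Set E) =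
      R ⁻¹' (Ioo (0 : ℝ) 1 • ((↑) '' s : Set E)) := by
    ext x
    simp only [mem_preimage, mem_smul]
    constructor
    · rintro ⟨t, ht, _, ⟨e, he, rfl⟩, rfl⟩
      exact ⟨t, ht, R e, ⟨sphereIsometry R e, he, rfl⟩, by simp⟩
    · rintro ⟨t, ht, _, ⟨e, he, rfl⟩, hx⟩
      refine ⟨t, ht, R.symm e, ⟨sphereIsometry R.symm e, ?_, rfl⟩, ?_⟩
      · rw [mem_preimage]
        convert he
        ext
        simp [sphereIsometry]
      · rw [← map_smul, hx, R.symm_apply_apply]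
  rw [h]
  congr 1
  exact R.measurePreserving.measure_preimage_equiv (f := R.toMeasurableEquiv) _

lemma integral_sphere_inner_sq_congr {v w : E} (h : ‖v‖ = ‖w‖) :
    ∫ e : sphere (0 : E) 1, inner ℝ v (e : E) ^ 2 ∂(volume : Measure E).toSphere =
      ∫ e : sphere (0 : E) 1, inner ℝ w (e : E) ^ 2 ∂(volume : Measure E).toSphere := by
  let R : E ≃ₗᵢ[ℝ] E := (Submodule.span ℝ {v - w})ᗮ.reflection
  have hR : R v = w := Submodule.reflection_sub h
  have hc : Continuous fun e : sphere (0 : E) 1 => inner ℝ w (e : E) ^ 2 := by fun_prop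
  rw [← (measurePreserving_sphereIsometry R).map_eq,
    integral_map (continuous_sphereIsometry R).aemeasurable
      hc.aestronglyMeasurable, (measurePreserving_sphereIsometry R).map_eq]
  refine integral_congr_ae (.of_forall fun e => ?_)
  simp [sphereIsometry, ← hR]

lemma integrable_sphere_inner_sq (v : E) :
    Integrable (fun e : sphere (0 : E) 1 => inner ℝ v (e : E) ^ 2)
      (volume : Measure E).toSphere :=
  have hc : Continuous fun e : sphere (0 : E) 1 => inner ℝ v (e : E) ^ 2 := by fun_prop
  hc.integrable_of_hasCompactSupport (.of_compactSpace _)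

/-- On the unit sphere, the mean of `⟪v, e⟫ ^ 2` is `‖v‖ ^ 2` divided by the dimension. -/
lemma finrank_mul_integral_sphere_inner_sq (v : E) :
    (Module.finrank ℝ E : ℝ) *
        ∫ e : sphere (0 : E) 1, inner ℝ v (e : E) ^ 2 ∂(volume : Measure E).toSphere =
      ‖v‖ ^ 2 * (volume : Measure E).toSphere.real univ := by
  let b := stdOrthonormalBasis ℝ E
  have h : ∀ i, ∫ e : sphere (0 : E) 1, inner ℝ (‖v‖ • b i) (e : E) ^ 2
        ∂(volume : Measure E).toSphere =
      ∫ e : sphere (0 : E) 1, inner ℝ v (e : E) ^ 2 ∂(volume : Measure E).toSphere := fun i =>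
    integral_sphere_inner_sq_congr (by simp [norm_smul, b.orthonormal.1])
  calc
    _ = ∑ i, ∫ e : sphere (0 : E) 1, inner ℝ (‖v‖ • b i) (e : E) ^ 2
        ∂(volume : Measure E).toSphere := by simp [h]
    _ = ∫ e : sphere (0 : E) 1, ‖v‖ ^ 2 ∂(volume : Measure E).toSphere := by
      rw [← integral_finsetSum _ fun i _ => integrable_sphere_inner_sq _]
      refine integral_congr_ae (.of_forall fun e => ?_)
      simp [inner_smul_left, mul_pow, ← Finset.mul_sum, b.sum_sq_inner_right]
    _ = _ := by simp [mul_comm]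

end Sphere

lemma MeasureTheory.Integrable.mul_of_abs_le_on_support {α : Type*} [MeasurableSpace α]
    {μ : Measure α} {g h : α → ℝ} (hg : Integrable g μ) (hh : Measurable h) {C : ℝ}
    (hC : ∀ x, g x ≠ 0 → |h x| ≤ C) : Integrable (fun x => g x * h x) μ := by
  refine (hg.norm.mul_const C).mono' (hg.aestronglyMeasurable.mul hh.aestronglyMeasurable)
    (.of_forall fun x => ?_)
  rw [norm_mul]
  by_cases hx : g x = 0
  · simp [hx]
  · exact mul_le_mul_of_nonneg_left (hC x hx) (norm_nonneg _)

section Directional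

variable {E : Type*} [NormedAddCommGroup E] [NormedSpace ℝ E]

lemma exists_rayInv_le {Ω K : Set E} (hΩ : IsOpen Ω) (hK : IsCompact K) (hKΩ : K ⊆ Ω) :
    ∃ M, ∀ x ∈ K, ∀ e : E, ‖e‖ = 1 → rayInv Ω x e ≤ M := by
  obtain ⟨δ, hδ, hsub⟩ := hK.exists_cthickening_subset_open hΩ hKΩ
  refine ⟨δ⁻¹, fun x hx e he => rayInv_le_inv hδ fun t ht => ?_⟩
  by_contra! h
  refine ht.2 (hsub (mem_cthickening_of_dist_le _ x δ K hx ?_))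
  simp [norm_smul, he, abs_of_nonneg ht.1, h.le]

lemma hasLineDerivAt_sq_mul_of_riccati {u A B : E → ℝ} {x e : E}
    (hu : DifferentiableAt ℝ u x)
    (hA : x ∈ tsupport u → HasLineDerivAt ℝ A (A x ^ 2) x e)
    (hB : x ∈ tsupport u → HasLineDerivAt ℝ B (-B x ^ 2) x e) :
    HasLineDerivAt ℝ (fun x => u x ^ 2 * ((B x - A x) / 2))
      (u x * fderiv ℝ u x e * (B x - A x) + u x ^ 2 * (-(A x ^ 2 + B x ^ 2) / 2)) x e := by
  by_cases hx : x ∈ tsupport u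
  · have h1 : HasLineDerivAt ℝ u (fderiv ℝ u x e) x e := hu.hasFDerivAt.hasLineDerivAt e
    have h2 := hA hx
    have h3 := hB hx
    unfold HasLineDerivAt at h1 h2 h3 ⊢
    refine ((h1.pow 2).mul ((h3.sub h2).div_const 2)).congr_deriv ?_
    simp
    ring
  · have h0 : u =ᶠ[nhds x] 0 := notMem_tsupport_iff_eventuallyEq.1 hx
    have h1 : HasLineDerivAt ℝ (fun _ : E => (0 : ℝ)) 0 x e := by
      simpa [HasLineDerivAt] using hasDerivAt_const (0 : ℝ) (0 : ℝ)
    rw [show u x = 0 from h0.eq_of_nhds]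
    simp only [zero_mul, ne_eq, OfNat.ofNat_ne_zero, not_false_eq_true, zero_pow, add_zero]
    refine h1.congr_of_eventuallyEq ?_
    filter_upwards [h0] with y hy
    simp [hy]

variable [FiniteDimensional ℝ E] [MeasurableSpace E] [BorelSpace E]

/-- Hardy's inequality in a fixed direction, for a pair of weights solving the Riccati equations
`A' = A ^ 2` and `B' = -B ^ 2` along that direction. -/
lemma integral_sq_mul_sq_le_of_riccati (μ : Measure E) [μ.IsAddHaarMeasure] {u A B : E → ℝ}
    (hu : ContDiff ℝ 1 u) (hcs : HasCompactSupport u) {e : E} {M : ℝ}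
    (hA0 : ∀ x, 0 ≤ A x) (hB0 : ∀ x, 0 ≤ B x)
    (hAM : ∀ x, u x ≠ 0 → A x ≤ M) (hBM : ∀ x, u x ≠ 0 → B x ≤ M)
    (hAm : Measurable A) (hBm : Measurable B)
    (hA : ∀ x ∈ tsupport u, HasLineDerivAt ℝ A (A x ^ 2) x e)
    (hB : ∀ x ∈ tsupport u, HasLineDerivAt ℝ B (-B x ^ 2) x e) :
    ∫ x, u x ^ 2 * (A x + B x) ^ 2 ∂μ ≤ 4 * ∫ x, fderiv ℝ u x e ^ 2 ∂μ := by
  set D : E → ℝ := fun x => fderiv ℝ u x e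
  have hDc : Continuous D := (hu.continuous_fderiv one_ne_zero).clm_apply continuous_const
  have hDcs : HasCompactSupport D := hcs.fderiv_apply ℝ e
  have hD2 : Integrable (fun x => D x ^ 2) μ := by
    simp_rw [sq]
    exact (hDc.mul hDc).integrable_of_hasCompactSupport hDcs.mul_left
  have hu2 : Integrable (fun x => u x ^ 2) μ := by
    simp_rw [sq]
    exact (hu.continuous.mul hu.continuous).integrable_of_hasCompactSupport hcs.mul_left
  have huD : Integrable (fun x => u x * D x) μ :=
    (hu.continuous.mul hDc).integrable_of_hasCompactSupport hcs.mul_right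
  have hlhs : Integrable (fun x => u x ^ 2 * (A x + B x) ^ 2) μ := by
    refine hu2.mul_of_abs_le_on_support (C := (M + M) ^ 2) (by fun_prop) fun x hx => ?_
    have hx : u x ≠ 0 := by simpa using hx
    rw [abs_of_nonneg (sq_nonneg _)]
    gcongr
    exacts [add_nonneg (hA0 x) (hB0 x), hAM x hx, hBM x hx]
  have hf : Integrable (fun x => u x ^ 2 * ((B x - A x) / 2)) μ := by
    refine hu2.mul_of_abs_le_on_support (C := M) (by fun_prop) fun x hx => ?_
    have hx : u x ≠ 0 := by simpa using hx
    rw [abs_le]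
    constructor <;> linarith [hA0 x, hB0 x, hAM x hx, hBM x hx]
  set f' : E → ℝ := fun x => u x * D x * (B x - A x) + u x ^ 2 * (-(A x ^ 2 + B x ^ 2) / 2)
    with hf'def
  have hf' : Integrable f' μ := by
    refine Integrable.add ?_ ?_
    · refine huD.mul_of_abs_le_on_support (C := M) (by fun_prop) fun x hx => ?_
      have hx : u x ≠ 0 := left_ne_zero_of_mul hx
      rw [abs_le]
      constructor <;> linarith [hA0 x, hB0 x, hAM x hx, hBM x hx]
    · refine hu2.mul_of_abs_le_on_support (C := M ^ 2) (by fun_prop) fun x hx => ?_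
      have hx : u x ≠ 0 := by simpa using hx
      have h1 := pow_le_pow_left₀ (hA0 x) (hAM x hx) 2
      have h2 := pow_le_pow_left₀ (hB0 x) (hBM x hx) 2
      rw [abs_le]
      constructor <;> nlinarith [sq_nonneg (A x), sq_nonneg (B x)]
  have hderiv : ∀ x, HasLineDerivAt ℝ (fun x => u x ^ 2 * ((B x - A x) / 2)) (f' x) x e :=
    fun x => hasLineDerivAt_sq_mul_of_riccati (hu.differentiable one_ne_zero x) (hA x) (hB x)
  have hint : ∫ x, f' x ∂μ = 0 := by
    have := integral_bilinear_hasLineDerivAt_right_eq_neg_left_of_integrable (μ := μ)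
      (B := ContinuousLinearMap.mul ℝ ℝ) (g := fun _ => 1) (g' := fun _ => 0) (f' := f')
      (f := fun x => u x ^ 2 * ((B x - A x) / 2)) (v := e)
      (by simpa using hf') (by simp) (by simpa using hf) (fun x _ => hderiv x)
      (fun x _ => by simpa [HasLineDerivAt] using hasDerivAt_const (0 : ℝ) (1 : ℝ))
    simpa using this.symm
  calc
    _ = ∫ x, (u x ^ 2 * (A x + B x) ^ 2 + 4 * f' x) ∂μ := by
      rw [integral_add hlhs (hf'.const_mul 4), integral_const_mul, hint]
      simp
    _ ≤ ∫ x, 4 * D x ^ 2 ∂μ := by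
      refine integral_mono (hlhs.add (hf'.const_mul 4)) (hD2.const_mul 4) fun x => ?_
      have := sq_nonneg (D x - u x * ((B x - A x) / 2))
      simp only [hf'def]
      nlinarith
    _ = _ := integral_const_mul _ _

/-- Hardy's inequality in a fixed direction. -/
lemma integral_sq_mul_rayInv_le (μ : Measure E) [μ.IsAddHaarMeasure] {Ω : Set E} (hΩ : IsOpen Ω)
    {u : E → ℝ} (hu : ContDiff ℝ 1 u) (hcs : HasCompactSupport u) (hsub : tsupport u ⊆ Ω) {e : E}
    (he : ‖e‖ = 1) :
    ∫ x, u x ^ 2 * (rayInv Ω x e + rayInv Ω x (-e)) ^ 2 ∂μ ≤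
      4 * ∫ x, fderiv ℝ u x e ^ 2 ∂μ := by
  obtain ⟨M, hM⟩ := exists_rayInv_le hΩ hcs hsub
  exact integral_sq_mul_sq_le_of_riccati μ hu hcs
    (fun x => rayInv_nonneg _ _ _) (fun x => rayInv_nonneg _ _ _)
    (fun x hx => hM x (subset_tsupport u hx) e he)
    (fun x hx => hM x (subset_tsupport u hx) (-e) (by simpa using he))
    (measurable_id.rayInv hΩ measurable_const) (measurable_id.rayInv hΩ measurable_const)
    (fun x hx => hasLineDerivAt_rayInv hΩ (hsub hx) e)
    (fun x hx => hasLineDerivAt_rayInv_neg hΩ (hsub hx) e)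

end Directional

lemma dirDist_nonneg {N : ℕ} (Ω : Set (EuclideanSpace ℝ (Fin N)))
    (x e : EuclideanSpace ℝ (Fin N)) : 0 ≤ dirDist Ω x e := by
  refine Real.sInf_nonneg ?_
  rintro _ ⟨t, rfl, -⟩
  exact abs_nonneg t

lemma inv_dirDist_le {N : ℕ} {Ω : Set (EuclideanSpace ℝ (Fin N))} (hΩ : IsOpen Ω)
    {x : EuclideanSpace ℝ (Fin N)} (hx : x ∈ Ω) (e : EuclideanSpace ℝ (Fin N)) :
    (dirDist Ω x e)⁻¹ ≤ rayInv Ω x e + rayInv Ω x (-e) := by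
  have hA := rayInv_nonneg Ω x e
  have hB := rayInv_nonneg Ω x (-e)
  rcases (dirDist_nonneg Ω x e).eq_or_lt with h | h
  · simpa [← h] using add_nonneg hA hB
  have hne : {r : ℝ | ∃ t : ℝ, r = |t| ∧ x + t • e ∈ Ωᶜ}.Nonempty := by
    by_contra h0
    rw [not_nonempty_iff_eq_empty] at h0
    rw [dirDist, h0, Real.sInf_empty] at h
    exact h.false
  have key : ∀ t : ℝ, x + t • e ∈ Ωᶜ → 0 < |t| ∧ |t|⁻¹ ≤ rayInv Ω x e + rayInv Ω x (-e) := by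
    intro t ht
    rcases le_total 0 t with h0 | h0
    · have hmem : t ∈ rayExit Ω x e := ⟨h0, ht⟩
      rw [abs_of_nonneg h0]
      exact ⟨pos_of_mem_rayExit hx hmem, by linarith [inv_le_rayInv hΩ hx hmem]⟩
    · have hmem : -t ∈ rayExit Ω x (-e) := ⟨by linarith, by simpa using ht⟩
      rw [abs_of_nonpos h0]
      exact ⟨pos_of_mem_rayExit hx hmem, by linarith [inv_le_rayInv hΩ hx hmem]⟩
  have hpos : 0 < rayInv Ω x e + rayInv Ω x (-e) := by
    obtain ⟨_, t, rfl, ht⟩ := hne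
    exact (inv_pos.2 (key t ht).1).trans_le (key t ht).2
  refine inv_le_of_inv_le₀ hpos (le_csInf hne ?_)
  rintro _ ⟨t, rfl, ht⟩
  exact inv_le_of_inv_le₀ (key t ht).1 (key t ht).2

lemma div_daviesWeight_sq {N : ℕ} (Ω : Set (EuclideanSpace ℝ (Fin N)))
    (x : EuclideanSpace ℝ (Fin N)) (a : ℝ) :
    a / daviesWeight Ω x ^ 2 = a * (N * ⨍ e : sphere (0 : EuclideanSpace ℝ (Fin N)) 1,
      (dirDist Ω x (e : EuclideanSpace ℝ (Fin N)) ^ 2)⁻¹ ∂volume.toSphere) := by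
  have h : 0 ≤ (N : ℝ) * ⨍ e : sphere (0 : EuclideanSpace ℝ (Fin N)) 1,
      (dirDist Ω x (e : EuclideanSpace ℝ (Fin N)) ^ 2)⁻¹ ∂volume.toSphere :=
    mul_nonneg N.cast_nonneg (integral_nonneg fun e => inv_nonneg.2 (sq_nonneg _))
  rw [daviesWeight, ← Real.rpow_natCast (_ ^ _), ← Real.rpow_mul h]
  norm_num [Real.rpow_neg_one, div_eq_mul_inv]

lemma integral_sphere_apply_sq_le {N : ℕ} (L : EuclideanSpace ℝ (Fin N) →L[ℝ] ℝ) :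
    ((volume : Measure (EuclideanSpace ℝ (Fin N))).toSphere.real univ)⁻¹ * N *
      ∫ e : sphere (0 : EuclideanSpace ℝ (Fin N)) 1, L e ^ 2 ∂volume.toSphere ≤ ‖L‖ ^ 2 := by
  have h := finrank_mul_integral_sphere_inner_sq
    ((InnerProductSpace.toDual ℝ (EuclideanSpace ℝ (Fin N))).symm L)
  simp only [InnerProductSpace.toDual_symm_apply, LinearIsometryEquiv.norm_map,
    finrank_euclideanSpace_fin] at h
  rw [mul_assoc, h, mul_comm, mul_assoc]
  exact mul_le_of_le_one_right (sq_nonneg _) (mul_inv_le_one)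

/-- **Davies' Hardy inequality** for arbitrary open sets: for `N ≥ 1`, every open `Ω ⊊ ℝ^N`
and every `u ∈ C_0^∞(Ω)`, `∫_Ω |∇u|² dx ≥ (1/4) ∫_Ω |u|²/D_Ω² dx`. -/
theorem davies_hardy (N : ℕ) (hN : 1 ≤ N) (Ω : Set (EuclideanSpace ℝ (Fin N)))
    (hΩ : IsOpen Ω) (hne : Ω ≠ Set.univ) (u : EuclideanSpace ℝ (Fin N) → ℝ)
    (hu : ContDiff ℝ (⊤ : ℕ∞) u) (husupp : HasCompactSupport u) (husub : tsupport u ⊆ Ω) :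
    (1 / 4) * ∫ x in Ω, u x ^ 2 / daviesWeight Ω x ^ 2 ≤
      ∫ x in Ω, ‖fderiv ℝ u x‖ ^ 2 := by
  have hu1 : ContDiff ℝ 1 u := hu.of_le (by exact_mod_cast le_top)
  set σ : Measure (sphere (0 : EuclideanSpace ℝ (Fin N)) 1) := volume.toSphere
  set c : ℝ := (σ.real univ)⁻¹ * N with hc
  have hc0 : 0 ≤ c := by positivity
  obtain ⟨M, hM⟩ := exists_rayInv_le hΩ husupp husub
  set H : EuclideanSpace ℝ (Fin N) → sphere (0 : EuclideanSpace ℝ (Fin N)) 1 → ℝ :=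
    fun x e => rayInv Ω x e + rayInv Ω x (-e)
  have hH0 : ∀ x e, 0 ≤ H x e := fun x e => add_nonneg (rayInv_nonneg ..) (rayInv_nonneg ..)
  have hHM : ∀ x e, u x ≠ 0 → H x e ^ 2 ≤ (M + M) ^ 2 := fun x e hx =>
    pow_le_pow_left₀ (hH0 x e) (add_le_add (hM x (subset_tsupport u hx) e (by simp))
      (hM x (subset_tsupport u hx) (-e) (by simp))) 2
  have hHm : Measurable fun p : EuclideanSpace ℝ (Fin N) ×
      sphere (0 : EuclideanSpace ℝ (Fin N)) 1 => H p.1 p.2 :=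
    have hm := measurable_subtype_coe.comp
      (measurable_snd (α := EuclideanSpace ℝ (Fin N)) (β := sphere (0 : EuclideanSpace ℝ (Fin N)) 1))
    (measurable_fst.rayInv hΩ hm).add (measurable_fst.rayInv hΩ hm.neg)
  have hu2 : Integrable fun x => u x ^ 2 := by
    simp_rw [sq]
    exact (hu.continuous.mul hu.continuous).integrable_of_hasCompactSupport husupp.mul_left
  have hint : Integrable (Function.uncurry fun x e => u x ^ 2 * H x e ^ 2)
      (volume.prod σ) := by
    refine (hu2.comp_fst σ).mul_of_abs_le_on_support (C := (M + M) ^ 2) (hHm.pow_const 2)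
      fun p hp => ?_
    rw [abs_of_nonneg (sq_nonneg _)]
    exact hHM p.1 p.2 (by simpa using hp)
  have hDc : Continuous (fderiv ℝ u) := hu1.continuous_fderiv one_ne_zero
  have hDcs : HasCompactSupport (fderiv ℝ u) := husupp.fderiv ℝ
  have hD2 : Integrable fun x => ‖fderiv ℝ u x‖ ^ 2 := by
    simp_rw [sq]
    exact (hDc.norm.mul hDc.norm).integrable_of_hasCompactSupport hDcs.norm.mul_left
  have hDint : Integrable (Function.uncurry fun x (e : sphere (0 : EuclideanSpace ℝ (Fin N)) 1) =>
      fderiv ℝ u x e ^ 2) (volume.prod σ) := by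
    have hcont : Continuous (Function.uncurry fun x
        (e : sphere (0 : EuclideanSpace ℝ (Fin N)) 1) => fderiv ℝ u x e ^ 2) :=
      ((hDc.comp continuous_fst).clm_apply (continuous_subtype_val.comp continuous_snd)).pow 2
    refine (hD2.comp_fst σ).mono' hcont.aestronglyMeasurable (.of_forall fun p => ?_)
    have := (fderiv ℝ u p.1).le_opNorm p.2
    simp only [norm_eq_of_mem_sphere, mul_one] at this
    simpa [Function.uncurry] using pow_le_pow_left₀ (norm_nonneg _) this 2
  have hpoint : ∀ x, u x ^ 2 / daviesWeight Ω x ^ 2 ≤ c * ∫ e, u x ^ 2 * H x e ^ 2 ∂σ := by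
    intro x
    rw [div_daviesWeight_sq, average_eq, smul_eq_mul, integral_const_mul]
    by_cases hx : u x = 0
    · simp [hx]
    have hle : ∫ e : sphere (0 : EuclideanSpace ℝ (Fin N)) 1,
        (dirDist Ω x (e : EuclideanSpace ℝ (Fin N)) ^ 2)⁻¹ ∂σ ≤ ∫ e, H x e ^ 2 ∂σ := by
      refine integral_mono_of_nonneg (.of_forall fun e => inv_nonneg.2 (sq_nonneg _)) ?_
        (.of_forall fun e => ?_)
      · refine (integrable_const ((M + M) ^ 2)).mono'
          ((hHm.comp measurable_prodMk_left).pow_const 2).aestronglyMeasurable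
          (.of_forall fun e => ?_)
        rw [Real.norm_of_nonneg (sq_nonneg _)]
        exact hHM x e hx
      · simp only
        rw [← inv_pow]
        exact pow_le_pow_left₀ (inv_nonneg.2 (dirDist_nonneg ..))
          (inv_dirDist_le hΩ (husub (subset_tsupport u hx)) e) 2
    calc
      _ = c * (u x ^ 2 * ∫ e : sphere (0 : EuclideanSpace ℝ (Fin N)) 1,
          (dirDist Ω x (e : EuclideanSpace ℝ (Fin N)) ^ 2)⁻¹ ∂σ) := by rw [hc]; ring
      _ ≤ _ := by gcongr
  have hΩu : ∫ x in Ω, u x ^ 2 / daviesWeight Ω x ^ 2 = ∫ x, u x ^ 2 / daviesWeight Ω x ^ 2 :=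
    setIntegral_eq_integral_of_forall_compl_eq_zero fun x hx => by
      simp [image_eq_zero_of_notMem_tsupport fun h => hx (husub h)]
  have hΩD : ∫ x in Ω, ‖fderiv ℝ u x‖ ^ 2 = ∫ x, ‖fderiv ℝ u x‖ ^ 2 :=
    setIntegral_eq_integral_of_forall_compl_eq_zero fun x hx => by
      simp [image_eq_zero_of_notMem_tsupport
        fun h => hx (husub (tsupport_fderiv_subset ℝ h))]
  rw [hΩu, hΩD]
  calc
    _ ≤ (1 / 4) * ∫ x, c * ∫ e, u x ^ 2 * H x e ^ 2 ∂σ := by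
      refine mul_le_mul_of_nonneg_left ?_ (by norm_num)
      exact integral_mono_of_nonneg
        (.of_forall fun x => div_nonneg (sq_nonneg _) (sq_nonneg _))
        (hint.integral_prod_left.const_mul c) (.of_forall hpoint)
    _ = (1 / 4) * (c * ∫ e, (∫ x, u x ^ 2 * H x e ^ 2) ∂σ) := by
      rw [integral_const_mul, integral_integral_swap hint]
    _ ≤ (1 / 4) * (c * ∫ e : sphere (0 : EuclideanSpace ℝ (Fin N)) 1,
        4 * (∫ x, fderiv ℝ u x e ^ 2) ∂σ) := by
      refine mul_le_mul_of_nonneg_left (mul_le_mul_of_nonneg_left ?_ hc0) (by norm_num)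
      refine integral_mono hint.integral_prod_right (hDint.integral_prod_right.const_mul 4)
        fun e => ?_
      exact integral_sq_mul_rayInv_le volume hΩ hu1 husupp husub (by simp)
    _ = ∫ x, c * ∫ e : sphere (0 : EuclideanSpace ℝ (Fin N)) 1, fderiv ℝ u x e ^ 2 ∂σ := by
      rw [integral_const_mul, integral_const_mul, integral_integral_swap hDint]
      ring
    _ ≤ ∫ x, ‖fderiv ℝ u x‖ ^ 2 :=
      integral_mono (hDint.integral_prod_left.const_mul c) hD2 fun x => integral_sphere_apply_sq_le _
end
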